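/- Let Q be a finite simple quandle whose cardinality is not a prime power, and let G = Inn Q be its inner automorphism group. Then the map ρ : Q → G sending q to the right translation ρ_q is injective, its image C = ρ(Q) is a single conjugacy class of G, and C generates G. -/

import Mathlib

universe u v

/-- A quandle: a set with a binary operation `◃` such that every right
translation `x ↦ x ◃ a` is bijective, the operation is right self-distributive,
and every element is idempotent. -/
class Quandle' (Q : Type u) where
  act : Q → Q → Q
  act_bijective : ∀ a : Q, Function.Bijective fun x => act x a
  act_distrib : ∀ a b c : Q, act (act a b) c = act (act a c) (act b c)
  act_self : ∀ a : Q, act a a = a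

infixl:65 " ◃ " => Quandle'.act

namespace Quandle'

/-- The right translation by `a`, as a permutation of the quandle. -/
noncomputable def rho {Q : Type u} [Quandle' Q] (a : Q) : Equiv.Perm Q :=
  Equiv.ofBijective _ (act_bijective a)

/-- The inner automorphism group of a quandle: the subgroup of the symmetric
group generated by the right translations. -/
noncomputable def Inn (Q : Type u) [Quandle' Q] : Subgroup (Equiv.Perm Q) :=
  Subgroup.closure (Set.range (rho : Q → Equiv.Perm Q))

/-- A quandle is connected if its inner automorphism group acts transitively. -/
def IsConnected (Q : Type u) [Quandle' Q] : Prop :=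
  ∀ x y : Q, ∃ g ∈ Inn Q, g x = y

/-- Quandle homomorphisms. -/
def IsHom {Q : Type u} {R : Type v} [Quandle' Q] [Quandle' R] (f : Q → R) : Prop :=
  ∀ a b : Q, f (a ◃ b) = f a ◃ f b

/-- A quandle is simple if it has more than one element and every quandle
homomorphism out of it is either injective or constant. -/
def IsSimple (Q : Type u) [Quandle' Q] : Prop :=
  Nontrivial Q ∧ ∀ (R : Type u) [Quandle' R] (f : Q → R), IsHom f →
    Function.Injective f ∨ ∀ a b : Q, f a = f b

/-- A block for the action of the inner automorphism group. -/
noncomputable def IsBlock (Q : Type u) [Quandle' Q] (B : Set Q) : Prop :=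
  ∀ g ∈ Inn Q, ⇑g '' B = B ∨ Disjoint (⇑g '' B) B

/-- A connected quandle is primitive if the action of its inner automorphism
group preserves no nontrivial partition into blocks. -/
noncomputable def IsPrimitive (Q : Type u) [Quandle' Q] : Prop :=
  IsConnected Q ∧ ∀ B : Set Q, IsBlock Q B → B.Subsingleton ∨ B = Set.univ

end Quandle'

open Quandle'

/-- The conjugacy class of transpositions in the symmetric group `S₅`. -/
abbrev Transposition5 : Type := {σ : Equiv.Perm (Fin 5) // σ.IsSwap}

/-- The conjugation quandle structure `a ◃ b = b⁻¹ * a * b` on the class of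
transpositions of `S₅`. -/
instance : Quandle' Transposition5 where
  act a b := ⟨b.1⁻¹ * a.1 * b.1, by
    obtain ⟨x, y, hxy, ha⟩ := a.2
    refine ⟨b.1⁻¹ x, b.1⁻¹ y, fun h => hxy (b.1⁻¹.injective h), ?_⟩
    rw [ha, Equiv.swap_apply_apply]
    group⟩
  act_bijective a := by
    constructor
    · intro x y h
      have := Subtype.ext_iff.mp h
      simp only [mul_left_cancel_iff, mul_right_cancel_iff] at this
      exact Subtype.ext this
    · intro y
      refine ⟨⟨a.1 * y.1 * a.1⁻¹, ?_⟩, Subtype.ext (by group)⟩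
      obtain ⟨x, z, hxz, hy⟩ := y.2
      refine ⟨a.1 x, a.1 z, fun h => hxz (a.1.injective h), ?_⟩
      rw [hy, Equiv.swap_apply_apply]
  act_distrib a b c := Subtype.ext (by simp only []; group)
  act_self a := Subtype.ext (by simp only []; group)

/-- The map sending `q` to its right translation, viewed as an element of the
inner automorphism group. -/
noncomputable def rhoInn (Q : Type) [Quandle' Q] (q : Q) : Inn Q :=
  ⟨rho q, Subgroup.subset_closure ⟨q, rfl⟩⟩

namespace Quandle'

@[simp]
theorem rho_apply {Q : Type u} [Quandle' Q] (a x : Q) : rho a x = x ◃ a := rfl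

/-- The trivial quandle structure `a ◃ b = a` on a type. -/
abbrev trivialQuandle (X : Type u) : Quandle' X where
  act a _ := a
  act_bijective _ := Function.bijective_id
  act_distrib _ _ _ := rfl
  act_self _ := rfl

/-- The conjugation quandle structure `a ◃ b = b * a * b⁻¹` on a group. -/
abbrev conjQuandle (G : Type u) [Group G] : Quandle' G where
  act a b := b * a * b⁻¹
  act_bijective b := (MulAut.conj b).bijective
  act_distrib a b c := by group
  act_self a := by group

/-- Inner automorphisms conjugate right translations to right translations. -/
theorem rho_apply_of_mem_inn {Q : Type u} [Quandle' Q] {g : Equiv.Perm Q} (hg : g ∈ Inn Q)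
    (x : Q) : rho (g x) = g * rho x * g⁻¹ := by
  induction hg using Subgroup.closure_induction generalizing x with
  | mem g hg =>
    obtain ⟨a, rfl⟩ := hg
    rw [eq_mul_inv_iff_mul_eq]
    ext y
    exact (act_distrib y x a).symm
  | one => simp
  | mul g h _ _ ihg ihh => rw [Equiv.Perm.mul_apply, ihg, ihh]; group
  | inv g _ ih =>
    have h := ih (g⁻¹ x)
    rw [← Equiv.Perm.mul_apply, mul_inv_cancel, Equiv.Perm.one_apply] at h
    rw [h]
    group

theorem rho_act {Q : Type u} [Quandle' Q] (a b : Q) :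
    rho (a ◃ b) = rho b * rho a * (rho b)⁻¹ :=
  rho_apply_of_mem_inn (Subgroup.subset_closure ⟨b, rfl⟩) a

/-- A simple quandle with trivial operation has exactly two elements. -/
theorem IsSimple.card_eq_two {Q : Type u} [Quandle' Q] [Fintype Q] (hs : IsSimple Q)
    (ht : ∀ a b : Q, a ◃ b = a) : Fintype.card Q = 2 := by
  classical
  obtain ⟨⟨a, b, hab⟩, hs⟩ := hs
  rw [← Finset.card_univ, Finset.card_eq_two]
  refine ⟨a, b, hab, ?_⟩
  rcases @hs Q (trivialQuandle Q) (fun x => if x = a then a else b)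
    (fun x y => by rw [ht]; rfl) with h | h
  · ext x
    by_cases hx : x = a
    · simp [hx]
    · simpa [hx] using @h x b (by simp [hx, hab.symm])
  · exact absurd (h a b) (by simp [hab, hab.symm])

/-- A simple quandle with nontrivial operation has injective `rho`. -/
theorem IsSimple.rho_injective {Q : Type u} [Quandle' Q] (hs : IsSimple Q)
    (ht : ¬ ∀ a b : Q, a ◃ b = a) : Function.Injective (rho : Q → Equiv.Perm Q) := by
  refine (@hs.2 (Equiv.Perm Q) (conjQuandle _) rho rho_act).resolve_right ?_
  intro h
  refine ht fun a b => ?_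
  rw [← rho_apply, h b a, rho_apply, act_self]

/-- A simple quandle with nontrivial operation is connected. -/
theorem IsSimple.isConnected {Q : Type u} [Quandle' Q] (hs : IsSimple Q)
    (ht : ¬ ∀ a b : Q, a ◃ b = a) : IsConnected Q := by
  have key (a b : Q) : (Quotient.mk (MulAction.orbitRel (Inn Q) Q) (a ◃ b)) =
      Quotient.mk (MulAction.orbitRel (Inn Q) Q) a :=
    Quotient.sound ⟨⟨rho b, Subgroup.subset_closure ⟨b, rfl⟩⟩, rfl⟩
  rcases @hs.2 (Quotient (MulAction.orbitRel (Inn Q) Q)) (trivialQuandle _)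
    (Quotient.mk _) key with h | h
  · exact absurd (fun a b => h (key a b)) ht
  · intro x y
    obtain ⟨g, hg⟩ := Quotient.exact (h y x)
    exact ⟨g, g.2, hg⟩

end Quandle'

/-- For a finite simple quandle `Q` whose cardinality is not a prime power,
the map `ρ : Q → G = Inn Q`, `q ↦ ρ_q`, is injective, its image
`C = ρ(Q)` is a single conjugacy class of `G`, and `C` generates `G`. -/
theorem simple_quandle_rho_injective_class_generates (Q : Type) [Quandle' Q] [Fintype Q]
    (hs : IsSimple Q) (hnpp : ¬ IsPrimePow (Fintype.card Q)) :
    Function.Injective (rhoInn Q) ∧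
    (∃ c : Inn Q, Set.range (rhoInn Q) = {x : Inn Q | IsConj c x}) ∧
    Subgroup.closure (Set.range (rhoInn Q)) = ⊤ := by
  have ht : ¬ ∀ a b : Q, a ◃ b = a := fun ht =>
    hnpp (hs.card_eq_two ht ▸ Nat.prime_two.isPrimePow)
  refine ⟨fun a b h => hs.rho_injective ht (congrArg Subtype.val h), ?_, ?_⟩
  · obtain ⟨q, -⟩ := hs.1
    refine ⟨rhoInn Q q, Set.ext fun x => ⟨?_, fun hx => ?_⟩⟩
    · rintro ⟨y, rfl⟩
      obtain ⟨g, hg, rfl⟩ := hs.isConnected ht q y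
      exact isConj_iff.2 ⟨⟨g, hg⟩, Subtype.ext (rho_apply_of_mem_inn hg q).symm⟩
    · obtain ⟨g, rfl⟩ := isConj_iff.1 hx
      exact ⟨g.1 q, Subtype.ext (rho_apply_of_mem_inn g.2 q)⟩
  · have h : Set.range (rhoInn Q) =
        ((↑) : Inn Q → Equiv.Perm Q) ⁻¹' Set.range (rho : Q → Equiv.Perm Q) := by
      ext x
      simp [rhoInn, Subtype.ext_iff]
    rw [h]
    exact Subgroup.closure_closure_coe_preimage
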